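/- Let A and B be nonempty closed convex subsets of X and set T := P_B ∘ P_A. Then 0 belongs to the closure of the range of Id − T but not to the range of Id − T itself if and only if T has no fixed point. -/

import Mathlib

open Filter Topology

variable {X : Type*} [NormedAddCommGroup X] [InnerProductSpace ℝ X] [FiniteDimensional ℝ X]

/-- `P` is the projector onto the set `C`: `P x` is a point of `C` nearest to `x`. -/
def IsProjector (C : Set X) (P : X → X) : Prop :=
  ∀ x : X, P x ∈ C ∧ ∀ y ∈ C, ‖x - P x‖ ≤ ‖x - y‖

omit [FiniteDimensional ℝ X] in
theorem IsProjector.inner_le_zero {C : Set X} {P : X → X} (hP : IsProjector C P)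
    (hC : Convex ℝ C) (x : X) {y : X} (hy : y ∈ C) :
    inner ℝ (x - P x) (y - P x) ≤ 0 := by
  have : Nonempty C := ⟨⟨P x, (hP x).1⟩⟩
  refine (norm_eq_iInf_iff_real_inner_le_zero hC (hP x).1).1 (le_antisymm ?_ ?_) y hy
  · exact le_ciInf fun w => (hP x).2 w w.2
  · exact ciInf_le (f := fun w : C => ‖x - w‖)
      ⟨0, Set.forall_mem_range.2 fun _ => norm_nonneg _⟩ ⟨P x, (hP x).1⟩

omit [FiniteDimensional ℝ X] in
theorem IsProjector.norm_sq_add_norm_sq_le {C : Set X} {P : X → X} (hP : IsProjector C P)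
    (hC : Convex ℝ C) (x : X) {y : X} (hy : y ∈ C) :
    ‖x - P x‖ ^ 2 + ‖y - P x‖ ^ 2 ≤ ‖x - y‖ ^ 2 := by
  have h := hP.inner_le_zero hC x hy
  have e : x - y = (x - P x) - (y - P x) := by abel
  rw [e, norm_sub_sq_real (x - P x)]
  linarith

omit [FiniteDimensional ℝ X] in
theorem zero_mem_closure_range_sub_comp_projector {A B : Set X} {PA PB : X → X}
    (hBne : B.Nonempty) (hBconv : Convex ℝ B) (hPA : IsProjector A PA) (hPB : IsProjector B PB) :
    (0 : X) ∈ closure (Set.range fun x : X => x - PB (PA x)) := by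
  rw [Metric.mem_closure_iff]
  intro ε hε
  let S : Set ℝ := (fun b => ‖b - PA b‖ ^ 2) '' B
  have hS : BddBelow S := ⟨0, Set.forall_mem_image.2 fun b _ => sq_nonneg ‖b - PA b‖⟩
  obtain ⟨_, ⟨b, hb, rfl⟩, hlt⟩ :=
    exists_lt_of_csInf_lt (hBne.image _) (lt_add_of_pos_right (sInf S) (pow_pos hε 2))
  refine ⟨_, ⟨b, rfl⟩, ?_⟩
  have hb' := (hPB (PA b)).1
  have hinf : sInf S ≤ ‖PB (PA b) - PA (PB (PA b))‖ ^ 2 := csInf_le hS ⟨_, hb', rfl⟩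
  have hle : ‖PB (PA b) - PA (PB (PA b))‖ ^ 2 ≤ ‖PA b - PB (PA b)‖ ^ 2 := by
    rw [norm_sub_rev (PA b)]
    exact pow_le_pow_left₀ (norm_nonneg _) ((hPA _).2 _ (hPA b).1) 2
  have hpyth := hPB.norm_sq_add_norm_sq_le hBconv (PA b) hb
  rw [norm_sub_rev (PA b) b] at hpyth
  rw [dist_zero_left]
  refine lt_of_pow_lt_pow_left₀ 2 hε.le ?_
  dsimp only at hlt
  linarith

/-- For `T = P_B ∘ P_A`:
`0 ∈ closure (ran (Id − T)) \ ran (Id − T)` if and only if `T` has no fixed point. -/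
theorem stmt7 (A B : Set X) (hAne : A.Nonempty) (hAcl : IsClosed A) (hAconv : Convex ℝ A)
    (hBne : B.Nonempty) (hBcl : IsClosed B) (hBconv : Convex ℝ B)
    (PA PB : X → X) (hPA : IsProjector A PA) (hPB : IsProjector B PB)
    (T : X → X) (hT : T = PB ∘ PA) :
    (0 : X) ∈ closure (Set.range fun x : X => x - T x) \ (Set.range fun x : X => x - T x)
      ↔ ∀ x : X, T x ≠ x := by
  subst hT
  constructor
  · rintro ⟨-, h⟩ x hx
    exact h ⟨x, sub_eq_zero.2 hx.symm⟩
  · intro h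
    refine ⟨zero_mem_closure_range_sub_comp_projector (PA := PA) (PB := PB) hBne hBconv hPA hPB, ?_⟩
    rintro ⟨x, hx⟩
    exact h x (sub_eq_zero.1 hx).symm
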